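/- Let R be a Cohen-Macaulay local ring of dimension d ≥ 3 with isolated singularity and canonical module ω, and let M be a maximal Cohen-Macaulay module with a free summand such that A = Hom_R(M,M) is maximal Cohen-Macaulay. If the global dimension of A is at most d, then ω belongs to add(M). -/

import Mathlib

universe u

open CategoryTheory Opposite IsLocalRing

def pdLE (A : Type u) [Ring A] : ℕ → ModuleCat.{u} A → Prop
  | 0, N => Module.Projective A N
  | n + 1, N => ∃ (ι : Type u) (f : (ι →₀ A) →ₗ[A] N), Function.Surjective f ∧
      pdLE A n (ModuleCat.of A (LinearMap.ker f))

/-- The global dimension of a ring, as an extended natural number. -/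
noncomputable def globalDimension (A : Type u) [Ring A] : ℕ∞ :=
  sInf {c : ℕ∞ | ∃ n : ℕ, c = (n : ℕ∞) ∧ ∀ N : ModuleCat.{u} A, pdLE A n N}

noncomputable abbrev ExtGroup (R : Type) [CommRing R] (i : ℕ)
    (M N : Type) [AddCommGroup M] [Module R M] [AddCommGroup N] [Module R N] : Type :=
  ((Ext R (ModuleCat R) i).obj (op (ModuleCat.of R M))).obj (ModuleCat.of R N)

noncomputable def moduleDepth (R : Type) [CommRing R] [IsLocalRing R]
    (M : Type) [AddCommGroup M] [Module R M] : ℕ∞ :=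
  sInf {i : ℕ∞ | ∃ n : ℕ, i = n ∧ Nontrivial (ExtGroup R n (ResidueField R) M)}

def IsCohenMacaulayLocalRing (R : Type) [CommRing R] [IsLocalRing R] : Prop :=
  IsNoetherianRing R ∧ ((moduleDepth R R : ℕ∞) : WithBot ℕ∞) = ringKrullDim R

def IsMCM (R : Type) [CommRing R] [IsLocalRing R]
    (M : Type) [AddCommGroup M] [Module R M] : Prop :=
  Module.Finite R M ∧ ((moduleDepth R M : ℕ∞) : WithBot ℕ∞) = ringKrullDim R

def IsCanonicalModule (R : Type) [CommRing R] [IsLocalRing R]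
    (ω : Type) [AddCommGroup ω] [Module R ω] : Prop :=
  Module.Finite R ω ∧
    (∀ i : ℕ, ((i : ℕ∞) : WithBot ℕ∞) ≠ ringKrullDim R →
      Subsingleton (ExtGroup R i (ResidueField R) ω)) ∧
    (∀ i : ℕ, ((i : ℕ∞) : WithBot ℕ∞) = ringKrullDim R →
      Nonempty (ExtGroup R i (ResidueField R) ω ≃ₗ[R] ResidueField R))

/-- A regular local ring: Noetherian local, with the maximal ideal generated by
`dim` elements. -/
def IsRegularLocal (A : Type) [CommRing A] [IsLocalRing A] : Prop :=
  IsNoetherianRing A ∧ ∃ s : Finset A,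
    Ideal.span (s : Set A) = IsLocalRing.maximalIdeal A ∧
      ((s.card : ℕ∞) : WithBot ℕ∞) = ringKrullDim A

/-- `X` lies in `add M`: `X` is a direct summand of a finite direct sum of copies
of `M`. -/
def InAdd (R : Type) [CommRing R] (M X : Type) [AddCommGroup M] [Module R M]
    [AddCommGroup X] [Module R X] : Prop :=
  ∃ (k : ℕ) (s : X →ₗ[R] (Fin k → M)) (r : (Fin k → M) →ₗ[R] X), r ∘ₗ s = LinearMap.id

set_option linter.unusedSectionVars false
set_option linter.unusedSimpArgs false

namespace CanAdd

open CategoryTheory CategoryTheory.Abelian CategoryTheory.Limits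

section ExtBasics

variable {R : Type} [CommRing R]

/-- The derived functor version of `Ext` and the derived category version vanish together. -/
theorem abExt_subsingleton_of_old (n : ℕ) (N X : ModuleCat.{0} R)
    (h : Subsingleton (((_root_.Ext R (ModuleCat R) n).obj (op N)).obj X)) :
    Subsingleton (Abelian.Ext N X n) := by
  let P := ProjectiveResolution.of N
  have hz : IsZero (((_root_.Ext R (ModuleCat R) n).obj (op N)).obj X) :=
    ModuleCat.isZero_of_subsingleton _
  have hz2 := hz.of_iso (P.isoExt n X).symm
  rw [← HomologicalComplex.exactAt_iff_isZero_homology] at hz2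
  refine subsingleton_of_forall_eq 0 fun α => ?_
  obtain ⟨f, hf, rfl⟩ := P.extMk_surjective α (n+1) rfl
  rcases n with _ | n
  · rw [HomologicalComplex.exactAt_iff' _ 0 0 1 (by simp) (by simp)] at hz2
    rw [ShortComplex.moduleCat_exact_iff] at hz2
    obtain ⟨g, hg⟩ := hz2 f hf
    have : f = 0 := by
      rw [← hg]
      simp
      rfl
    subst this
    simp
  · rw [HomologicalComplex.exactAt_iff' _ n (n+1) (n+2) (by simp) (by simp)] at hz2
    rw [ShortComplex.moduleCat_exact_iff] at hz2
    obtain ⟨g, hg⟩ := hz2 f hf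
    exact (P.extMk_eq_zero_iff f _ rfl hf n rfl).2 ⟨g, hg⟩

/-- Vanishing of `Ext^i_R(N, X)`. -/
def EZ (R : Type) [CommRing R] (N X : Type) [AddCommGroup N] [Module R N] [AddCommGroup X]
    [Module R X] (i : ℕ) : Prop :=
  Subsingleton (Abelian.Ext (ModuleCat.of R N) (ModuleCat.of R X) i)

variable {N : Type} [AddCommGroup N] [Module R N]
variable {X : Type} [AddCommGroup X] [Module R X]
variable {X₁ : Type} [AddCommGroup X₁] [Module R X₁]
variable {X₂ : Type} [AddCommGroup X₂] [Module R X₂]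
variable {X₃ : Type} [AddCommGroup X₃] [Module R X₃]

theorem EZ.of_old {i : ℕ} (h : Subsingleton (ExtGroup R i N X)) : EZ R N X i :=
  abExt_subsingleton_of_old i _ _ h

/-- Short complex of an exact pair of linear maps. -/
abbrev scx (f : X₁ →ₗ[R] X₂) (g : X₂ →ₗ[R] X₃) (h : Function.Exact f g) :
    ShortComplex (ModuleCat.{0} R) :=
  ShortComplex.mk (ModuleCat.ofHom f) (ModuleCat.ofHom g)
    (by ext x; exact h.apply_apply_eq_zero x)

theorem scx_shortExact (f : X₁ →ₗ[R] X₂) (g : X₂ →ₗ[R] X₃) (h : Function.Exact f g)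
    (hf : Function.Injective f) (hg : Function.Surjective g) : (scx f g h).ShortExact where
  exact := by
    rw [ShortComplex.moduleCat_exact_iff]
    intro x hx
    exact (h x).1 hx
  mono_f := (ModuleCat.mono_iff_injective _).2 hf
  epi_g := (ModuleCat.epi_iff_surjective _).2 hg

theorem EZ.eq_zero {i : ℕ} (h : EZ R N X i)
    (e : Abelian.Ext (ModuleCat.of R N) (ModuleCat.of R X) i) : e = 0 :=
  h.elim _ _

theorem EZ.cov1 {i : ℕ} {f : X₁ →ₗ[R] X₂} {g : X₂ →ₗ[R] X₃} (h : Function.Exact f g)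
    (hf : Function.Injective f) (hg : Function.Surjective g)
    (h3 : EZ R N X₃ i) (h2 : EZ R N X₂ (i + 1)) : EZ R N X₁ (i + 1) := by
  refine subsingleton_of_forall_eq 0 fun e => ?_
  obtain ⟨y, rfl⟩ := Ext.covariant_sequence_exact₁ _ (scx_shortExact f g h hf hg) e
    (h2.eq_zero _) rfl
  rw [h3.eq_zero y, Ext.zero_comp]

theorem EZ.cov2 {i : ℕ} {f : X₁ →ₗ[R] X₂} {g : X₂ →ₗ[R] X₃} (h : Function.Exact f g)
    (hf : Function.Injective f) (hg : Function.Surjective g)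
    (h1 : EZ R N X₁ i) (h3 : EZ R N X₃ i) : EZ R N X₂ i := by
  refine subsingleton_of_forall_eq 0 fun e => ?_
  obtain ⟨y, rfl⟩ := Ext.covariant_sequence_exact₂ _ (scx_shortExact f g h hf hg) e
    (h3.eq_zero _)
  rw [h1.eq_zero y, Ext.zero_comp]

theorem EZ.cov3 {i : ℕ} {f : X₁ →ₗ[R] X₂} {g : X₂ →ₗ[R] X₃} (h : Function.Exact f g)
    (hf : Function.Injective f) (hg : Function.Surjective g)
    (h2 : EZ R N X₂ i) (h1 : EZ R N X₁ (i + 1)) : EZ R N X₃ i := by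
  refine subsingleton_of_forall_eq 0 fun e => ?_
  obtain ⟨y, rfl⟩ := Ext.covariant_sequence_exact₃ _ (scx_shortExact f g h hf hg) e rfl
    (h1.eq_zero _)
  rw [h2.eq_zero y, Ext.zero_comp]

theorem EZ.contra1 {i : ℕ} {f : X₁ →ₗ[R] X₂} {g : X₂ →ₗ[R] X₃} (h : Function.Exact f g)
    (hf : Function.Injective f) (hg : Function.Surjective g)
    (h2 : EZ R X₂ X i) (h3 : EZ R X₃ X (i + 1)) : EZ R X₁ X i := by
  refine subsingleton_of_forall_eq 0 fun e => ?_
  obtain ⟨y, rfl⟩ := Ext.contravariant_sequence_exact₁ (scx_shortExact f g h hf hg) _ e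
    (add_comm 1 i) (h3.eq_zero _)
  rw [h2.eq_zero y, Ext.comp_zero]

theorem EZ.contra2 {i : ℕ} {f : X₁ →ₗ[R] X₂} {g : X₂ →ₗ[R] X₃} (h : Function.Exact f g)
    (hf : Function.Injective f) (hg : Function.Surjective g)
    (h1 : EZ R X₁ X i) (h3 : EZ R X₃ X i) : EZ R X₂ X i := by
  refine subsingleton_of_forall_eq 0 fun e => ?_
  obtain ⟨y, rfl⟩ := Ext.contravariant_sequence_exact₂ (scx_shortExact f g h hf hg) _ e
    (h1.eq_zero _)
  rw [h3.eq_zero y, Ext.comp_zero]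

theorem EZ.of_projective [Module.Projective R N] (i : ℕ) : EZ R N X (i + 1) := by
  have : Projective (ModuleCat.of R N) := by
    rw [← IsProjective.iff_projective]; infer_instance
  exact subsingleton_of_forall_eq 0 fun e => e.eq_zero_of_projective

theorem EZ.retract {i : ℕ} (s : X₁ →ₗ[R] X₂) (r : X₂ →ₗ[R] X₁) (hrs : ∀ x, r (s x) = x)
    (h : EZ R N X₂ i) : EZ R N X₁ i := by
  refine subsingleton_of_forall_eq 0 fun e => ?_
  have hid : ModuleCat.ofHom s ≫ ModuleCat.ofHom r = 𝟙 (ModuleCat.of R X₁) := by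
    ext x; exact hrs x
  have h1 : (e.comp (Ext.mk₀ (ModuleCat.ofHom s)) (add_zero i)).comp
      (Ext.mk₀ (ModuleCat.ofHom r)) (add_zero i) = e := by
    rw [Ext.comp_assoc_of_third_deg_zero, Ext.mk₀_comp_mk₀, hid, Ext.comp_mk₀_id]
  rw [← h1, h.eq_zero (e.comp _ _), Ext.zero_comp]

theorem EZ.zero_iff : EZ R N X 0 ↔ Subsingleton (N →ₗ[R] X) :=
  (Ext.linearEquiv₀ (R := R).trans ModuleCat.homLinearEquiv).toEquiv.subsingleton_congr

theorem EZ.zero_of_injective (f : X₁ →ₗ[R] X₂) (hf : Function.Injective f)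
    (h : EZ R N X₂ 0) : EZ R N X₁ 0 := by
  rw [EZ.zero_iff] at h ⊢
  refine subsingleton_of_forall_eq 0 fun e => ?_
  ext x
  apply hf
  have : f ∘ₗ e = 0 := h.elim _ _
  simpa using LinearMap.congr_fun this x

theorem EZ.of_subsingleton [Subsingleton X] (i : ℕ) : EZ R N X i := by
  refine subsingleton_of_forall_eq 0 fun e => ?_
  have hid : 𝟙 (ModuleCat.of R X) = 0 := by
    ext x; exact Subsingleton.elim _ _
  rw [← Ext.comp_mk₀_id e, hid, Ext.mk₀_zero, Ext.comp_zero]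

theorem EZ.pi {i : ℕ} (h : EZ R N X i) (k : ℕ) : EZ R N (Fin k → X) i := by
  induction k with
  | zero => exact EZ.of_subsingleton i
  | succ k ih =>
    refine EZ.cov2 (f := LinearMap.single R (fun _ : Fin (k + 1) => X) 0)
      (g := LinearMap.funLeft R X (Fin.succ : Fin k → Fin (k + 1))) ?_ ?_ ?_ h ih
    · intro y
      constructor
      · intro hy
        refine ⟨y 0, ?_⟩
        funext j
        refine Fin.cases ?_ (fun j => ?_) j
        · simp
        · simpa using (congrFun hy j).symm
      · rintro ⟨x, rfl⟩
        funext j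
        simp [LinearMap.funLeft]
    · exact Pi.single_injective (M := fun _ : Fin (k + 1) => X) 0
    · intro y
      exact ⟨Fin.cons 0 y, by funext j; simp [LinearMap.funLeft]⟩

theorem EZ.nakayama [IsLocalRing R] [IsNoetherianRing R] [Module.Finite R N] [Module.Finite R X]
    {i : ℕ} {x : R} (hx : x ∈ IsLocalRing.maximalIdeal R) (hreg : IsSMulRegular N x)
    {Q : Type} [AddCommGroup Q] [Module R Q] {q : N →ₗ[R] Q} (hq : Function.Surjective q)
    (hex : Function.Exact (LinearMap.lsmul R N x) q)
    (h : EZ R Q X (i + 1)) : EZ R N X i := by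
  have key : ∀ e : Abelian.Ext (ModuleCat.of R N) (ModuleCat.of R X) i, ∃ e', x • e' = e := by
    intro e
    obtain ⟨y, hy⟩ := Ext.contravariant_sequence_exact₁ (scx_shortExact _ q hex hreg hq) _ e
      (add_comm 1 i) (h.eq_zero _)
    refine ⟨y, ?_⟩
    rw [← hy]
    have : ModuleCat.ofHom (LinearMap.lsmul R N x) = x • 𝟙 (ModuleCat.of R N) := rfl
    change _ = (Ext.mk₀ (ModuleCat.ofHom (LinearMap.lsmul R N x))).comp y _
    rw [this, Ext.mk₀_smul, Ext.smul_comp, Ext.mk₀_id_comp]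
  have htop : (⊤ : Submodule R (Abelian.Ext (ModuleCat.of R N) (ModuleCat.of R X) i)) = ⊥ := by
    have : Module.Finite R (ModuleCat.of R N) := ‹Module.Finite R N›
    have : Module.Finite R (ModuleCat.of R X) := ‹Module.Finite R X›
    refine Submodule.eq_bot_of_le_smul_of_le_jacobson_bot (IsLocalRing.maximalIdeal R) _
      (Module.Finite.fg_top) ?_ (IsLocalRing.maximalIdeal_le_jacobson _)
    intro e _
    obtain ⟨e', rfl⟩ := key e
    exact Submodule.smul_mem_smul hx trivial
  exact subsingleton_of_forall_eq 0 fun e => by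
    have : e ∈ (⊤ : Submodule R _) := trivial
    rwa [htop, Submodule.mem_bot] at this

end ExtBasics

end CanAdd

namespace CanAdd

open CategoryTheory CategoryTheory.Abelian CategoryTheory.Limits

section Canonical

variable {R : Type} [CommRing R]

theorem EZ.extend {X₁ X₂ X₃ Y : Type} [AddCommGroup X₁] [Module R X₁] [AddCommGroup X₂]
    [Module R X₂] [AddCommGroup X₃] [Module R X₃] [AddCommGroup Y] [Module R Y]
    {f : X₁ →ₗ[R] X₂} {g : X₂ →ₗ[R] X₃} (h : Function.Exact f g)
    (hf : Function.Injective f) (hg : Function.Surjective g)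
    (h3 : EZ R X₃ Y 1) (φ : X₁ →ₗ[R] Y) : ∃ ψ : X₂ →ₗ[R] Y, ψ ∘ₗ f = φ := by
  obtain ⟨y, hy⟩ := Ext.contravariant_sequence_exact₁ (scx_shortExact f g h hf hg) _
    (Ext.mk₀ (ModuleCat.ofHom φ)) (add_comm 1 0) (h3.eq_zero _)
  obtain ⟨ψ, rfl⟩ := Ext.homEquiv₀.symm.surjective y
  refine ⟨ψ.hom, ?_⟩
  have h2 : ModuleCat.ofHom f ≫ ψ = ModuleCat.ofHom φ := by
    apply Ext.homEquiv₀.symm.injective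
    simpa using hy
  have h3 := congrArg ModuleCat.Hom.hom h2
  simpa using h3

variable [IsLocalRing R] [IsNoetherianRing R]

theorem dichotomy (N : Type) [AddCommGroup N] [Module R N] [Module.Finite R N] :
    (∃ x ∈ IsLocalRing.maximalIdeal R, IsSMulRegular N x) ∨
      ∃ φ : ResidueField R →ₗ[R] N, φ ≠ 0 := by
  by_cases h : Subsingleton (ResidueField R →ₗ[R] N)
  · left
    rw [IsSMulRegular.subsingleton_linearMap_iff] at h
    obtain ⟨x, hx, hr⟩ := h
    refine ⟨x, ?_, hr⟩
    have h1 := Module.mem_annihilator.mp hx (1 : ResidueField R)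
    rw [Algebra.smul_def, mul_one] at h1
    exact (IsLocalRing.residue_eq_zero_iff x).1 h1
  · right
    by_contra! h2
    exact h (subsingleton_of_forall_eq 0 h2)

theorem residue_smul_eq_zero {x : R} (hx : x ∈ IsLocalRing.maximalIdeal R)
    (y : ResidueField R) : x • y = 0 := by
  rw [Algebra.smul_def]
  have : algebraMap R (ResidueField R) x = 0 := (IsLocalRing.residue_eq_zero_iff x).2 hx
  rw [this, zero_mul]

theorem residue_map_injective {N : Type} [AddCommGroup N] [Module R N]
    (φ : ResidueField R →ₗ[R] N) (h : φ ≠ 0) : Function.Injective φ := by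
  rw [injective_iff_map_eq_zero]
  intro y hy
  by_contra hne
  apply h
  ext z
  obtain ⟨r, hr⟩ := IsLocalRing.residue_surjective (z * y⁻¹)
  have hz : z = r • y := by
    rw [Algebra.smul_def]
    change z = IsLocalRing.residue R r * y
    rw [hr]
    field_simp
  rw [hz, map_smul, hy, smul_zero]
  rfl

theorem exists_residue_map {N : Type} [AddCommGroup N] [Module R N] (n : N)
    (h : ∀ x ∈ IsLocalRing.maximalIdeal R, x • n = 0) (hn : n ≠ 0) :
    ¬ EZ R (ResidueField R) N 0 := by
  rw [EZ.zero_iff]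
  intro hs
  let φ : ResidueField R →ₗ[R] N :=
    (Submodule.liftQ (IsLocalRing.maximalIdeal R) (LinearMap.toSpanSingleton R N n)
      (fun x hx => by simpa using h x hx) : (R ⧸ IsLocalRing.maximalIdeal R) →ₗ[R] N)
  have h0 : φ = 0 := hs.elim _ _
  apply hn
  have : φ (IsLocalRing.residue R 1) = n := by
    change (LinearMap.toSpanSingleton R N n) 1 = n
    simp
  rw [← this, h0]
  rfl

theorem exists_factor {N : Type} [AddCommGroup N] [Module R N] (L : Submodule R N)
    (S : Submodule R (N ⧸ L)) (hS : S ≠ ⊥) :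
    ∃ L' : Submodule R N, L < L' ∧ ∃ q : (N ⧸ L) →ₗ[R] (N ⧸ L'), Function.Surjective q ∧
      ∀ y, q y = 0 ↔ y ∈ S := by
  have hle : L ≤ S.comap L.mkQ := by
    intro y hy
    rw [Submodule.mem_comap, Submodule.mkQ_apply, (Submodule.Quotient.mk_eq_zero L).2 hy]
    exact S.zero_mem
  refine ⟨S.comap L.mkQ, lt_of_le_of_ne hle ?_, Submodule.factor hle,
    Submodule.factor_surjective hle, ?_⟩
  · intro he
    apply hS
    rw [Submodule.eq_bot_iff]
    intro y hy
    obtain ⟨z, rfl⟩ := L.mkQ_surjective y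
    rw [Submodule.mkQ_apply, Submodule.Quotient.mk_eq_zero, he]
    exact hy
  · intro y
    obtain ⟨z, rfl⟩ := L.mkQ_surjective y
    simp

/-- Bass: vanishing on the residue field above `d` gives vanishing on all finite modules. -/
theorem EZ.above {ω : Type} [AddCommGroup ω] [Module R ω] [Module.Finite R ω] {d : ℕ}
    (hk : ∀ i, d < i → EZ R (ResidueField R) ω i)
    (N : Type) [AddCommGroup N] [Module R N] [Module.Finite R N] (L : Submodule R N) :
    ∀ i, d < i → EZ R (N ⧸ L) ω i := by
  induction L using IsNoetherian.induction with
  | hgt L ih =>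
  intro i hi
  rcases dichotomy (R := R) (N ⧸ L) with ⟨x, hx, hreg⟩ | ⟨φ, hφ⟩
  · by_cases hs : Subsingleton (N ⧸ L)
    · obtain ⟨i, rfl⟩ : ∃ j, i = j + 1 := ⟨i - 1, by omega⟩
      exact EZ.of_projective i
    · obtain ⟨L', hlt, q, hq, hker⟩ := exists_factor L (LinearMap.range (LinearMap.lsmul R (N ⧸ L) x)) (by
        intro he
        apply hs
        refine subsingleton_of_forall_eq 0 fun y => ?_
        apply hreg
        rw [LinearMap.range_eq_bot] at he
        simpa using LinearMap.congr_fun he y)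
      exact EZ.nakayama hx hreg hq (fun y => hker y) (ih L' hlt (i + 1) (by omega))
  · obtain ⟨L', hlt, q, hq, hker⟩ := exists_factor L (LinearMap.range φ) (by
      rwa [Ne, LinearMap.range_eq_bot])
    exact EZ.contra2 (f := φ) (g := q) (fun y => hker y) (residue_map_injective φ hφ) hq
      (hk i hi) (ih L' hlt i hi)

theorem EZ.depth_vanish {ω : Type} [AddCommGroup ω] [Module R ω] [Module.Finite R ω] {d : ℕ}
    (hk : ∀ i, d < i → EZ R (ResidueField R) ω i) (n : ℕ) :
    ∀ (N : Type) [AddCommGroup N] [Module R N] [Module.Finite R N],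
    (∀ j, j < n → EZ R (ResidueField R) N j) → ∀ i, d < i + n → EZ R N ω i := by
  induction n with
  | zero =>
    intro N _ _ _ _ i hi
    exact EZ.contra2 (f := (0 : (⊥ : Submodule R N) →ₗ[R] N)) (g := (⊥ : Submodule R N).mkQ)
      (fun y => by
        simp only [Submodule.mkQ_apply, Submodule.Quotient.mk_eq_zero, Submodule.mem_bot]
        constructor
        · rintro rfl
          exact ⟨0, rfl⟩
        · rintro ⟨_, rfl⟩
          rfl) (Function.injective_of_subsingleton _) (Submodule.mkQ_surjective _)
      (by
        obtain ⟨i, rfl⟩ : ∃ j, i = j + 1 := ⟨i - 1, by omega⟩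
        exact EZ.of_projective i)
      (EZ.above hk N ⊥ i (by simpa using hi))
  | succ n ih =>
    intro N _ _ _ hN i hi
    rcases dichotomy (R := R) N with ⟨x, hx, hreg⟩ | ⟨φ, hφ⟩
    · have hex : Function.Exact (LinearMap.lsmul R N x)
          (LinearMap.range (LinearMap.lsmul R N x)).mkQ := by
        intro y
        rw [Submodule.mkQ_apply, Submodule.Quotient.mk_eq_zero]
        rfl
      refine EZ.nakayama hx hreg (Submodule.mkQ_surjective _) hex (ih _ ?_ (i + 1) (by omega))
      intro j hj
      exact EZ.cov3 hex hreg (Submodule.mkQ_surjective _) (hN j (by omega))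
        (hN (j + 1) (by omega))
    · have := EZ.zero_iff.1 (hN 0 (by omega))
      exact absurd (this.elim φ 0) hφ

theorem EZ.dual_depth {ω : Type} [AddCommGroup ω] [Module R ω] [Module.Finite R ω] {d : ℕ}
    (hk : ∀ i, i < d → EZ R (ResidueField R) ω i) (j : ℕ) :
    ∀ (N : Type) [AddCommGroup N] [Module R N] [Module.Finite R N],
    (∀ i, 0 < i → EZ R N ω i) → j < d → EZ R (ResidueField R) (N →ₗ[R] ω) j := by
  have hfree : ∀ (n i : ℕ), i < d → EZ R (ResidueField R) ((Fin n → R) →ₗ[R] ω) i := by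
    intro n i hi
    have e : ((Fin n → R) →ₗ[R] ω) ≃ₗ[R] (Fin n → ω) := (Pi.basisFun R (Fin n)).constr R |>.symm
    exact EZ.retract e.toLinearMap e.symm.toLinearMap (fun x => by simp) ((hk i hi).pi n)
  induction j with
  | zero =>
    intro N _ _ _ hN hj
    obtain ⟨n, p, hp⟩ := Module.Finite.exists_fin' R N
    refine EZ.zero_of_injective (LinearMap.lcomp R ω p) ?_ (hfree n 0 hj)
    intro a b hab
    ext y
    obtain ⟨z, rfl⟩ := hp y
    exact LinearMap.congr_fun hab z
  | succ j ih =>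
    intro N _ _ _ hN hj
    obtain ⟨n, p, hp⟩ := Module.Finite.exists_fin' R N
    have hex : Function.Exact (LinearMap.ker p).subtype p := by
      intro y; simp
    refine EZ.cov1 (f := LinearMap.lcomp R ω p) (g := LinearMap.lcomp R ω (LinearMap.ker p).subtype)
      ?_ ?_ ?_ (ih (LinearMap.ker p) ?_ (by omega)) (hfree n _ hj)
    · intro g
      constructor
      · intro hg
        refine ⟨(LinearMap.ker p).liftQ g ?_ ∘ₗ (p.quotKerEquivOfSurjective hp).symm.toLinearMap, ?_⟩
        · intro y hy
          exact LinearMap.congr_fun hg ⟨y, hy⟩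
        · refine LinearMap.ext fun y => ?_
          have : (p.quotKerEquivOfSurjective hp).symm (p y) = Submodule.Quotient.mk y := by
            rw [LinearEquiv.symm_apply_eq]
            rfl
          simp only [LinearMap.lcomp_apply, LinearMap.comp_apply, LinearEquiv.coe_coe]
          rw [this]
          rfl
      · rintro ⟨g, rfl⟩
        refine LinearMap.ext fun y => ?_
        have : p y = 0 := y.2
        simp [this]
    · intro a b hab
      ext y
      obtain ⟨z, rfl⟩ := hp y
      exact LinearMap.congr_fun hab z
    · intro φ
      obtain ⟨ψ, hψ⟩ := EZ.extend hex (Submodule.subtype_injective _) hp (hN 1 one_pos) φ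
      exact ⟨ψ, hψ⟩
    · intro i hi
      obtain ⟨i, rfl⟩ : ∃ j, i = j + 1 := ⟨i - 1, by omega⟩
      exact EZ.contra1 hex (Submodule.subtype_injective _) hp (EZ.of_projective i)
        (hN _ (by omega))

end Canonical

end CanAdd

namespace CanAdd

open CategoryTheory CategoryTheory.Abelian CategoryTheory.Limits
open scoped TensorProduct

section Tens

variable {R : Type} [CommRing R] {A : Type} [Ring A] [Algebra R A]
variable {X : Type} [AddCommGroup X] [Module R X] (act : X →ₗ[R] A →ₗ[R] X)
variable (N : Type) [AddCommGroup N] [Module R N] [Module A N] [IsScalarTower R A N]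
variable {N₁ : Type} [AddCommGroup N₁] [Module R N₁] [Module A N₁] [IsScalarTower R A N₁]
variable {N₂ : Type} [AddCommGroup N₂] [Module R N₂] [Module A N₂] [IsScalarTower R A N₂]
variable {N₃ : Type} [AddCommGroup N₃] [Module R N₃] [Module A N₃] [IsScalarTower R A N₃]

/-- The relations defining `X ⊗_A N` as a quotient of `X ⊗_R N`. -/
def rel : Submodule R (X ⊗[R] N) :=
  Submodule.span R {t | ∃ (x : X) (a : A) (n : N), t = act x a ⊗ₜ[R] n - x ⊗ₜ[R] (a • n)}

/-- The tensor product `X ⊗_A N` for a right module `X` and a left module `N`. -/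
abbrev Tens : Type := (X ⊗[R] N) ⧸ rel act N

variable {N}

/-- Pure tensors in `X ⊗_A N`. -/
def pure (x : X) (n : N) : Tens act N := (rel act N).mkQ (x ⊗ₜ[R] n)

theorem pure_act (x : X) (a : A) (n : N) : pure act (act x a) n = pure act x (a • n) := by
  unfold pure
  rw [← sub_eq_zero, ← map_sub, Submodule.mkQ_apply, Submodule.Quotient.mk_eq_zero]
  exact Submodule.subset_span ⟨x, a, n, rfl⟩

theorem tens_induction {P : Tens act N → Prop} (t : Tens act N) (h0 : P 0)
    (hp : ∀ x n, P (pure act x n)) (hadd : ∀ s t, P s → P t → P (s + t)) : P t := by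
  obtain ⟨t, rfl⟩ := (rel act N).mkQ_surjective t
  induction t using TensorProduct.induction_on with
  | zero => simpa using h0
  | tmul x n => exact hp x n
  | add s t hs ht => rw [map_add]; exact hadd _ _ hs ht

theorem rel_map_le (f : N₁ →ₗ[A] N₂) :
    rel act N₁ ≤ (rel act N₂).comap (LinearMap.lTensor X (f.restrictScalars R)) := by
  unfold rel
  rw [Submodule.span_le]
  rintro _ ⟨x, a, n, rfl⟩
  apply Submodule.subset_span
  exact ⟨x, a, f n, by simp⟩

/-- Functoriality of `X ⊗_A -`. -/
def tmap (f : N₁ →ₗ[A] N₂) : Tens act N₁ →ₗ[R] Tens act N₂ :=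
  Submodule.mapQ _ _ (LinearMap.lTensor X (f.restrictScalars R)) (rel_map_le act f)

@[simp] theorem tmap_pure (f : N₁ →ₗ[A] N₂) (x : X) (n : N₁) :
    tmap act f (pure act x n) = pure act x (f n) := rfl

theorem pure_add (x : X) (n n' : N) : pure act x (n + n') = pure act x n + pure act x n' := by
  simp [pure, TensorProduct.tmul_add]

theorem pure_zero (x : X) : pure act x (0 : N) = 0 := by
  simp [pure]

theorem pure_smul (x : X) (r : R) (n : N) : pure act x (r • n) = r • pure act x n := by
  simp [pure]

theorem tmap_comp (f : N₁ →ₗ[A] N₂) (g : N₂ →ₗ[A] N₃) (t : Tens act N₁) :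
    tmap act g (tmap act f t) = tmap act (g ∘ₗ f) t := by
  induction t using tens_induction with
  | h0 => simp
  | hp x n => simp
  | hadd s t hs ht => simp [hs, ht]

theorem tmap_smul (f : N →ₗ[A] N) (r : R) (h : ∀ n, f n = r • n) (t : Tens act N) :
    tmap act f t = r • t := by
  induction t using tens_induction with
  | h0 => simp
  | hp x n => simp [h, pure_smul]
  | hadd s t hs ht => simp [hs, ht]

theorem tmap_id (f : N →ₗ[A] N) (h : ∀ n, f n = n) (t : Tens act N) : tmap act f t = t := by
  simpa using tmap_smul act f 1 (by simpa using h) t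

/-- Multiplication by a central element as an `A`-linear map. -/
def xmul (A : Type) [Ring A] [Algebra R A] (x : R)
    (N : Type) [AddCommGroup N] [Module R N] [Module A N] [IsScalarTower R A N] : N →ₗ[A] N where
  toFun n := x • n
  map_add' := smul_add x
  map_smul' a n := by
    have : SMulCommClass R A N := IsScalarTower.to_smulCommClass
    exact smul_comm x a n

theorem xmul_apply (A : Type) [Ring A] [Algebra R A] (x : R)
    (N : Type) [AddCommGroup N] [Module R N] [Module A N] [IsScalarTower R A N] (n : N) :
    xmul A x N n = x • n := rfl

theorem tmap_zero (f : N₁ →ₗ[A] N₂) (h : ∀ n, f n = 0) (t : Tens act N₁) : tmap act f t = 0 := by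
  induction t using tens_induction with
  | h0 => simp
  | hp x n => simp [h, pure_zero]
  | hadd s t hs ht => simp [hs, ht]

theorem tmap_surjective (g : N₁ →ₗ[A] N₂) (hg : Function.Surjective g) :
    Function.Surjective (tmap act g) := by
  intro t
  induction t using tens_induction with
  | h0 => exact ⟨0, by simp⟩
  | hp x n =>
    obtain ⟨m, rfl⟩ := hg n
    exact ⟨pure act x m, rfl⟩
  | hadd s t hs ht =>
    obtain ⟨s, rfl⟩ := hs
    obtain ⟨t, rfl⟩ := ht
    exact ⟨s + t, map_add _ _ _⟩

theorem rel_lift (g : N₁ →ₗ[A] N₂) (hg : Function.Surjective g) :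
    rel act N₂ ≤ (rel act N₁).map (LinearMap.lTensor X (g.restrictScalars R)) := by
  conv_lhs => unfold rel
  rw [Submodule.span_le]
  rintro _ ⟨x, a, n, rfl⟩
  obtain ⟨m, rfl⟩ := hg n
  exact ⟨act x a ⊗ₜ[R] m - x ⊗ₜ[R] (a • m), Submodule.subset_span ⟨x, a, m, rfl⟩, by simp⟩

theorem tmap_exact (f : N₁ →ₗ[A] N₂) (g : N₂ →ₗ[A] N₃) (h : Function.Exact f g)
    (hg : Function.Surjective g) : Function.Exact (tmap act f) (tmap act g) := by
  intro t
  constructor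
  · intro ht
    obtain ⟨t, rfl⟩ := (rel act N₂).mkQ_surjective t
    have ht' : LinearMap.lTensor X (g.restrictScalars R) t ∈ rel act N₃ := by
      rw [← Submodule.Quotient.mk_eq_zero]
      exact ht
    obtain ⟨u, hu, hut⟩ := rel_lift act g hg ht'
    have hex := lTensor_exact X (f := f.restrictScalars R) (g := g.restrictScalars R) h hg
    obtain ⟨s, hs⟩ := (hex (t - u)).1 (by rw [map_sub, hut, sub_self])
    refine ⟨(rel act N₁).mkQ s, ?_⟩
    have h1 : tmap act f ((rel act N₁).mkQ s)
        = (rel act N₂).mkQ (LinearMap.lTensor X (f.restrictScalars R) s) := rfl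
    have h2 : (rel act N₂).mkQ u = 0 := by
      rw [Submodule.mkQ_apply, Submodule.Quotient.mk_eq_zero]
      exact hu
    rw [h1, hs, map_sub, h2, sub_zero]
  · rintro ⟨s, rfl⟩
    rw [tmap_comp]
    exact tmap_zero act _ (fun n => h.apply_apply_eq_zero n) s

instance tens_finite [Module.Finite R X] [Module.Finite R N] : Module.Finite R (Tens act N) :=
  inferInstance

/-- The comparison map `X ⊗_A A^k → X^k`. -/
def toPi (hmul : ∀ x a b, act x (a * b) = act (act x a) b) (k : ℕ) :
    Tens act (Fin k → A) →ₗ[R] (Fin k → X) :=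
  (rel act (Fin k → A)).liftQ
    (LinearMap.pi fun i => TensorProduct.lift (act.compl₂ (LinearMap.proj i))) (by
      unfold rel
      rw [Submodule.span_le]
      rintro _ ⟨x, a, n, rfl⟩
      simp only [SetLike.mem_coe, LinearMap.mem_ker, map_sub, sub_eq_zero]
      funext i
      simp [hmul])

theorem toPi_pure (hmul : ∀ x a b, act x (a * b) = act (act x a) b) (k : ℕ) (x : X)
    (v : Fin k → A) : toPi act hmul k (pure act x v) = fun i => act x (v i) := rfl

/-- The inverse comparison map `X^k → X ⊗_A A^k`. -/
def ofPi (k : ℕ) : (Fin k → X) →ₗ[R] Tens act (Fin k → A) :=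
  ∑ i : Fin k, ((rel act (Fin k → A)).mkQ ∘ₗ
    (TensorProduct.mk R X (Fin k → A)).flip (Pi.single i 1)) ∘ₗ LinearMap.proj i

theorem ofPi_apply (k : ℕ) (v : Fin k → X) :
    ofPi act k v = ∑ i : Fin k, pure act (v i) (Pi.single i (1 : A)) := by
  simp [ofPi, pure]

theorem pure_sum (x : X) {ι : Type} (s : Finset ι) (n : ι → N) :
    pure act x (∑ i ∈ s, n i) = ∑ i ∈ s, pure act x (n i) := by
  simp [pure, TensorProduct.tmul_sum]

theorem ofPi_toPi (hmul : ∀ x a b, act x (a * b) = act (act x a) b) (k : ℕ)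
    (t : Tens act (Fin k → A)) : ofPi act k (toPi act hmul k t) = t := by
  induction t using tens_induction with
  | h0 => simp
  | hp x v =>
    rw [toPi_pure, ofPi_apply]
    simp only [pure_act]
    rw [← pure_sum]
    congr 1
    funext j
    simp [Finset.sum_apply, Pi.single_apply]
  | hadd s t hs ht => simp [hs, ht]

end Tens

section Flat

variable {R : Type} [CommRing R] [IsLocalRing R] [IsNoetherianRing R]
variable {A : Type} [Ring A] [Algebra R A] [Module.Finite R A]
variable {X : Type} [AddCommGroup X] [Module R X] (act : X →ₗ[R] A →ₗ[R] X)

theorem noeth_A (R : Type) [CommRing R] [IsNoetherianRing R]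
    (A : Type) [Ring A] [Algebra R A] [Module.Finite R A] : IsNoetherianRing A := by
  have : IsNoetherian R A := inferInstance
  exact isNoetherian_of_tower R this

theorem tens_depth_of_projective (hmul : ∀ x a b, act x (a * b) = act (act x a) b)
    {i : ℕ} (hX : EZ R (ResidueField R) X i)
    (N : Type) [AddCommGroup N] [Module R N] [Module A N] [IsScalarTower R A N]
    [Module.Finite A N] [Module.Projective A N] : EZ R (ResidueField R) (Tens act N) i := by
  obtain ⟨k, p, hp⟩ := Module.Finite.exists_fin' A N
  obtain ⟨s, hs⟩ := Module.projective_lifting_property p LinearMap.id hp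
  refine EZ.retract (tmap act s) (tmap act p) ?_ (EZ.retract (toPi act hmul k) (ofPi act k)
    (ofPi_toPi act hmul k) (hX.pi k))
  intro t
  rw [tmap_comp, hs]
  exact tmap_id act _ (fun _ => rfl) t

theorem tmap_injective_of_depth
    {Ω P : Type} [AddCommGroup Ω] [Module R Ω] [Module A Ω] [IsScalarTower R A Ω]
    [AddCommGroup P] [Module R P] [Module A P] [IsScalarTower R A P]
    (ι : Ω →ₗ[A] P)
    (hβ : ∀ x ∈ IsLocalRing.maximalIdeal R, ∃ β : P →ₗ[A] Ω, ∀ w, β (ι w) = x • w)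
    (h : EZ R (ResidueField R) (Tens act Ω) 0) : Function.Injective (tmap act ι) := by
  rw [injective_iff_map_eq_zero]
  intro t ht
  by_contra hne
  refine exists_residue_map t (fun x hx => ?_) hne h
  obtain ⟨β, hβ⟩ := hβ x hx
  rw [← tmap_smul act (β ∘ₗ ι) x hβ, ← tmap_comp, ht, map_zero]

theorem acyclic (hmul : ∀ x a b, act x (a * b) = act (act x a) b)
    {d : ℕ} (hX : ∀ i, i < d → EZ R (ResidueField R) X i) (n : ℕ) (hn : n < d) :
    ∀ (Ω P : Type) [AddCommGroup Ω] [Module R Ω] [Module A Ω] [IsScalarTower R A Ω]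
    [AddCommGroup P] [Module R P] [Module A P] [IsScalarTower R A P]
    [Module.Finite A Ω] [Module.Projective A P]
    (_ : HasProjectiveDimensionLT (ModuleCat.of A Ω) (n + 1))
    (ι : Ω →ₗ[A] P)
    (_ : ∀ x ∈ IsLocalRing.maximalIdeal R, ∃ β : P →ₗ[A] Ω, ∀ w, β (ι w) = x • w),
    (∀ j, j + n < d → EZ R (ResidueField R) (Tens act Ω) j) ∧
      Function.Injective (tmap act ι) := by
  have : IsNoetherianRing A := noeth_A R A
  induction n with
  | zero =>
    intro Ω P _ _ _ _ _ _ _ _ _ _ hpd ι hβ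
    have hproj : Projective (ModuleCat.of A Ω) :=
      projective_iff_hasProjectiveDimensionLT_one.2 hpd
    have : Module.Projective A Ω := (IsProjective.iff_projective Ω).2 hproj
    have hdep : ∀ j, j + 0 < d → EZ R (ResidueField R) (Tens act Ω) j := fun j hj =>
      tens_depth_of_projective act hmul (hX j hj) Ω
    exact ⟨hdep, tmap_injective_of_depth act ι hβ (hdep 0 (by omega))⟩
  | succ n ih =>
    intro Ω P _ _ _ _ _ _ _ _ _ _ hpd ι hβ
    obtain ⟨k, p, hp⟩ := Module.Finite.exists_fin' A Ω
    have hex : Function.Exact (LinearMap.ker p).subtype p := by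
      intro y; simp
    have hpd' : HasProjectiveDimensionLT (ModuleCat.of A (LinearMap.ker p)) (n + 1) := by
      have hS := LinearMap.shortExact_shortComplexKer hp
      have hpr : Projective (ModuleCat.of A (Fin k → A)) :=
        (IsProjective.iff_projective _).1 inferInstance
      exact (hS.hasProjectiveDimensionLT_X₃_iff n hpr).1 hpd
    obtain ⟨hd', hinj⟩ := ih (by omega) (LinearMap.ker p) (Fin k → A) hpd'
      (LinearMap.ker p).subtype (by
        intro x hx
        obtain ⟨β, hβ⟩ := hβ x hx
        obtain ⟨β', hβ'⟩ := Module.projective_lifting_property p β hp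
        have hβ'' : ∀ y, p (β' y) = β y := fun y => LinearMap.congr_fun hβ' y
        have hpx : ∀ v, p (x • v) = x • p v := fun v => (p.restrictScalars R).map_smul x v
        refine ⟨LinearMap.codRestrict _ (xmul A x (Fin k → A) - β' ∘ₗ ι ∘ₗ p) ?_, ?_⟩
        · intro v
          simp [xmul_apply, hpx, hβ'', hβ]
        · intro w
          ext1
          have : p w = 0 := w.2
          change x • (w : Fin k → A) - β' (ι (p w)) = x • (w : Fin k → A)
          rw [this, map_zero, map_zero, sub_zero])
    have hdep : ∀ j, j + (n + 1) < d → EZ R (ResidueField R) (Tens act Ω) j := fun j hj =>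
      EZ.cov3 (tmap_exact act _ p hex hp) hinj (tmap_surjective act p hp)
        (tens_depth_of_projective act hmul (hX j (by omega)) _) (hd' (j + 1) (by omega))
    exact ⟨hdep, tmap_injective_of_depth act ι hβ (hdep 0 (by omega))⟩

end Flat

end CanAdd

namespace CanAdd

open CategoryTheory CategoryTheory.Abelian CategoryTheory.Limits
open scoped TensorProduct

section Flat2

variable {R : Type} [CommRing R] [IsLocalRing R] [IsNoetherianRing R]
variable {A : Type} [Ring A] [Algebra R A] [Module.Finite R A]
variable {X : Type} [AddCommGroup X] [Module R X] (act : X →ₗ[R] A →ₗ[R] X)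

theorem base (hmul : ∀ x a b, act x (a * b) = act (act x a) b)
    {d : ℕ} (hd : 0 < d) (hX : ∀ i, i < d → EZ R (ResidueField R) X i)
    (hgl : ∀ N : ModuleCat.{0} A, HasProjectiveDimensionLT N (d + 1))
    (I : Submodule A A) (hI : ∀ x ∈ IsLocalRing.maximalIdeal R, algebraMap R A x ∈ I) :
    Function.Injective (tmap act I.subtype) := by
  have : IsNoetherianRing A := noeth_A R A
  obtain ⟨n, rfl⟩ : ∃ n, d = n + 1 := ⟨d - 1, by omega⟩
  have hpd : HasProjectiveDimensionLT (ModuleCat.of A I) (n + 1) := by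
    have hS := LinearMap.shortExact_shortComplexKer (f := I.mkQ) I.mkQ_surjective
    have hpr : Projective (ModuleCat.of A A) :=
      (IsProjective.iff_projective _).1 inferInstance
    have h := (hS.hasProjectiveDimensionLT_X₃_iff n hpr).1 (hgl _)
    change HasProjectiveDimensionLT (ModuleCat.of A (LinearMap.ker I.mkQ)) (n + 1) at h
    rwa [Submodule.ker_mkQ] at h
  refine (acyclic act hmul hX n (by omega) I A hpd I.subtype ?_).2
  intro x hx
  refine ⟨LinearMap.toSpanSingleton A I ⟨algebraMap R A x, hI x hx⟩, fun w => ?_⟩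
  ext
  simp [Algebra.smul_def, Algebra.commutes]

theorem step {L Q J : Type} [AddCommGroup L] [Module R L] [Module A L] [IsScalarTower R A L]
    [AddCommGroup Q] [Module R Q] [Module A Q] [IsScalarTower R A Q]
    [AddCommGroup J] [Module R J] [Module A J] [IsScalarTower R A J]
    (K : Submodule A L) (q0 : Q →ₗ[A] L)
    (hK' : Function.Injective (tmap act (K ⊔ LinearMap.range q0).subtype))
    (j1 : J →ₗ[A] K) (j2 : J →ₗ[A] Q)
    (hj : ∀ (k : K) (q : Q), (k : L) + q0 q = 0 → ∃ s, j1 s = k ∧ j2 s = q)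
    (hj0 : ∀ s, (j1 s : L) + q0 (j2 s) = 0)
    (t : Tens act K) (ht : tmap act K.subtype t = 0) :
    ∃ s, tmap act j1 s = t ∧ tmap act j2 s = 0 := by
  let q : (K × Q) →ₗ[A] (K ⊔ LinearMap.range q0 : Submodule A L) :=
    LinearMap.codRestrict _ (K.subtype.coprod q0) (fun c =>
      Submodule.add_mem_sup c.1.2 ⟨c.2, rfl⟩)
  have hqv : ∀ c, (q c : L) = c.1 + q0 c.2 := fun c => rfl
  have hqs : Function.Surjective q := by
    rintro ⟨y, hy⟩
    obtain ⟨k, hk, _, ⟨c, rfl⟩, h⟩ := Submodule.mem_sup.1 hy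
    exact ⟨(⟨k, hk⟩, c), Subtype.ext h⟩
  have hex : Function.Exact (j1.prod j2) q := by
    rintro ⟨k, c⟩
    constructor
    · intro h
      obtain ⟨s, h1, h2⟩ := hj k c (by rw [← hqv (k, c), h]; rfl)
      exact ⟨s, Prod.ext h1 h2⟩
    · rintro ⟨s, hs⟩
      rw [← hs]
      exact Subtype.ext (hj0 s)
  have h0 : tmap act q (tmap act (LinearMap.inl A K Q) t) = 0 := by
    apply hK'
    rw [map_zero, tmap_comp, tmap_comp, ← ht]
    congr 2
    ext k
    simp [hqv]
  obtain ⟨s, hs⟩ := (tmap_exact act _ q hex hqs _).1 h0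
  refine ⟨s, ?_, ?_⟩
  · have := congrArg (tmap act (LinearMap.fst A K Q)) hs
    rw [tmap_comp, tmap_comp, LinearMap.fst_prod] at this
    rw [this]
    exact tmap_id act _ (fun n => rfl) t
  · have := congrArg (tmap act (LinearMap.snd A K Q)) hs
    rw [tmap_comp, tmap_comp, LinearMap.snd_prod] at this
    rw [this]
    exact tmap_zero act _ (fun n => rfl) t

theorem flat [Module.Finite R X] (hmul : ∀ x a b, act x (a * b) = act (act x a) b)
    {d : ℕ} (hd : 0 < d) (hX : ∀ i, i < d → EZ R (ResidueField R) X i)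
    (hgl : ∀ N : ModuleCat.{0} A, HasProjectiveDimensionLT N (d + 1))
    (L : Type) [AddCommGroup L] [Module R L] [Module A L] [IsScalarTower R A L]
    [Module.Finite R L] (K : Submodule A L) :
    Function.Injective (tmap act K.subtype) := by
  have hnL : IsNoetherian A L := isNoetherian_of_tower R inferInstance
  induction K using IsNoetherian.induction with
  | hgt K ih =>
  have hfK : Module.Finite R K :=
    Module.Finite.of_injective (K.subtype.restrictScalars R) K.injective_subtype
  have hfQ : Module.Finite R (L ⧸ K) :=
    Module.Finite.of_surjective (K.mkQ.restrictScalars R) K.mkQ_surjective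
  by_cases hKT : K = ⊤
  · rw [injective_iff_map_eq_zero]
    intro t ht
    let e : L →ₗ[A] K := LinearMap.codRestrict K LinearMap.id (fun c => by simp [hKT])
    rw [← tmap_id act (e ∘ₗ K.subtype) (fun n => rfl) t, ← tmap_comp, ht, map_zero]
  rcases dichotomy (R := R) (L ⧸ K) with ⟨x, hx, hreg⟩ | ⟨φ, hφ⟩
  · have hxK : ∀ l : L, x • l ∈ K → l ∈ K := by
      intro l hl
      rw [← Submodule.Quotient.mk_eq_zero K] at hl ⊢
      apply hreg
      simpa using hl
    have hlt : K < K ⊔ LinearMap.range (xmul A x L) := by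
      refine lt_of_le_of_ne le_sup_left fun h => hKT ?_
      rw [eq_top_iff]
      intro l _
      apply hxK
      rw [h]
      exact Submodule.mem_sup_right ⟨l, rfl⟩
    have hst := step act K (xmul A x L) (ih _ hlt) (-(xmul A x K)) K.subtype
      (fun k c h => by
        have hc : c ∈ K := hxK c (by
          have : x • c = -(k : L) := by rw [eq_neg_iff_add_eq_zero, add_comm]; exact h
          rw [this]; exact K.neg_mem k.2)
        refine ⟨⟨c, hc⟩, ?_, rfl⟩
        ext
        have : x • c = -(k : L) := by rw [eq_neg_iff_add_eq_zero, add_comm]; exact h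
        change -(x • c) = (k : L)
        rw [this, neg_neg])
      (fun s => by
        change -(x • (s : L)) + x • (s : L) = 0
        exact neg_add_cancel _)
    rw [← LinearMap.ker_eq_bot]
    refine Submodule.eq_bot_of_le_smul_of_le_jacobson_bot (IsLocalRing.maximalIdeal R) _
      (IsNoetherian.noetherian _) ?_ (IsLocalRing.maximalIdeal_le_jacobson _)
    intro t ht
    obtain ⟨s, hs, hs'⟩ := hst t ht
    rw [tmap_smul act _ (-x) (fun n => by rw [neg_smul]; rfl)] at hs
    rw [← hs]
    exact Submodule.smul_mem_smul (neg_mem hx) hs'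
  · have : ∃ y, φ y ≠ 0 := by
      by_contra! h
      exact hφ (LinearMap.ext h)
    obtain ⟨y, hy⟩ := this
    obtain ⟨l, hl⟩ := K.mkQ_surjective (φ y)
    have hlK : l ∉ K := fun h => hy (by rw [← hl]; simpa using h)
    have hml : ∀ x ∈ IsLocalRing.maximalIdeal R, x • l ∈ K := by
      intro x hx
      rw [← Submodule.Quotient.mk_eq_zero K]
      have : x • φ y = 0 := by rw [← map_smul, residue_smul_eq_zero hx, map_zero]
      rw [← hl] at this
      exact this
    let q0 : A →ₗ[A] L := LinearMap.toSpanSingleton A L l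
    have hlt : K < K ⊔ LinearMap.range q0 := by
      refine lt_of_le_of_ne le_sup_left fun h => hlK ?_
      rw [h]
      exact Submodule.mem_sup_right ⟨1, by simp [q0]⟩
    let I : Submodule A A := K.comap q0
    have hI : ∀ x ∈ IsLocalRing.maximalIdeal R, algebraMap R A x ∈ I := by
      intro x hx
      change algebraMap R A x • l ∈ K
      rw [algebraMap_smul]
      exact hml x hx
    let j : I →ₗ[A] K := LinearMap.codRestrict K (q0 ∘ₗ I.subtype) (fun c => c.2)
    have hst := step act K q0 (ih _ hlt) (-j) I.subtype
      (fun k c h => by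
        have hc : q0 c = -(k : L) := by rw [eq_neg_iff_add_eq_zero, add_comm]; exact h
        refine ⟨⟨c, ?_⟩, ?_, rfl⟩
        · change q0 c ∈ K
          rw [hc]; exact K.neg_mem k.2
        · ext
          change -(q0 c) = (k : L)
          rw [hc, neg_neg])
      (fun s => by
        change -(q0 (s : A)) + q0 (s : A) = 0
        exact neg_add_cancel _)
    rw [injective_iff_map_eq_zero]
    intro t ht
    obtain ⟨s, hs, hs'⟩ := hst t ht
    have : s = 0 := base act hmul hd hX hgl I hI (by rw [hs', map_zero])
    rw [← hs, this, map_zero]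

end Flat2

theorem pd_of_pdLE (A : Type) [Ring A] (n : ℕ) :
    ∀ N : ModuleCat.{0} A, pdLE A n N → HasProjectiveDimensionLT N (n + 1) := by
  induction n with
  | zero =>
    intro N h
    have : Module.Projective A N := h
    exact projective_iff_hasProjectiveDimensionLT_one.1 ((IsProjective.iff_projective N).1 this)
  | succ n ih =>
    rintro N ⟨ι, f, hf, h⟩
    have hS := LinearMap.shortExact_shortComplexKer hf
    have hpr : Projective (ModuleCat.of A (ι →₀ A)) :=
      (IsProjective.iff_projective _).1 inferInstance
    exact (hS.hasProjectiveDimensionLT_X₃_iff n hpr).2 (ih _ h)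

theorem pd_of_gl (A : Type) [Ring A] (d : ℕ) (h : globalDimension A ≤ (d : ℕ∞))
    (N : ModuleCat.{0} A) : HasProjectiveDimensionLT N (d + 1) := by
  unfold globalDimension at h
  have hne : {c : ℕ∞ | ∃ n : ℕ, c = (n : ℕ∞) ∧ ∀ N : ModuleCat.{0} A, pdLE A n N}.Nonempty := by
    by_contra hne
    rw [Set.not_nonempty_iff_eq_empty] at hne
    rw [hne, sInf_empty] at h
    simp at h
  obtain ⟨n, hn, hN⟩ := csInf_mem hne
  rw [hn] at h
  have hnd : n ≤ d := by exact_mod_cast h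
  have := pd_of_pdLE A n N (hN N)
  exact hasProjectiveDimensionLT_of_ge N (n + 1) (d + 1) (by omega)

end CanAdd

namespace CanAdd

open CategoryTheory CategoryTheory.Abelian CategoryTheory.Limits
open scoped TensorProduct

/-- The right action of `End M` on `Hom(M, ω)`. -/
def actHom (R M ω : Type) [CommRing R] [AddCommGroup M] [Module R M] [AddCommGroup ω]
    [Module R ω] : (M →ₗ[R] ω) →ₗ[R] Module.End R M →ₗ[R] (M →ₗ[R] ω) :=
  LinearMap.mk₂ R (fun φ a => φ ∘ₗ a) (fun _ _ _ => LinearMap.add_comp _ _ _)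
    (fun _ _ _ => LinearMap.smul_comp _ _ _) (fun _ _ _ => LinearMap.comp_add _ _ _)
    (fun _ _ _ => LinearMap.comp_smul _ _ _)

theorem actHom_apply (R M ω : Type) [CommRing R] [AddCommGroup M] [Module R M] [AddCommGroup ω]
    [Module R ω] (φ : M →ₗ[R] ω) (a : Module.End R M) : actHom R M ω φ a = φ ∘ₗ a := rfl

/-- Precomposition with a map of free-type modules, as an `End M`-linear map. -/
def precomp {R M : Type} [CommRing R] [AddCommGroup M] [Module R M] {k l : ℕ}
    (g : (Fin l → M) →ₗ[R] (Fin k → M)) :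
    (Fin k → Module.End R M) →ₗ[Module.End R M] (Fin l → Module.End R M) where
  toFun κ j := ∑ i, κ i ∘ₗ LinearMap.proj i ∘ₗ g ∘ₗ LinearMap.single R (fun _ => M) j
  map_add' κ κ' := by
    funext j
    simp [LinearMap.add_comp, Finset.sum_add_distrib]
  map_smul' a κ := by
    funext j
    ext m
    simp [LinearMap.sum_apply]

theorem inAdd_of_surj {R M ω : Type} [CommRing R] [IsLocalRing R] [IsNoetherianRing R]
    [AddCommGroup M] [Module R M] [AddCommGroup ω] [Module R ω]
    [Module.Finite R M] [Module.Finite R ω]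
    {d : ℕ} (hd : 0 < d) (hX : ∀ i, i < d → EZ R (ResidueField R) (M →ₗ[R] ω) i)
    (hgl : ∀ N : ModuleCat.{0} (Module.End R M), HasProjectiveDimensionLT N (d + 1))
    {k l : ℕ} (π : (Fin k → M) →ₗ[R] ω) (hπ : Function.Surjective π)
    (g : (Fin l → M) →ₗ[R] (Fin k → M)) (hg : LinearMap.range g = LinearMap.ker π) :
    InAdd R M ω := by
  have hfA : Module.Finite R (Module.End R M) := inferInstanceAs (Module.Finite R (M →ₗ[R] M))
  let act := actHom R M ω
  have hmul : ∀ x a b, act x (a * b) = act (act x a) b := fun x a b => rfl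
  let ρ := precomp g
  have hρ : ∀ κ j m, ρ κ j m = ∑ i, κ i (g (Pi.single j m) i) := by
    intro κ j m
    simp [ρ, precomp, LinearMap.sum_apply]
  let φ : Fin k → (M →ₗ[R] ω) := fun i => π ∘ₗ LinearMap.single R (fun _ => M) i
  have hsum : ∀ v : Fin k → M, ∑ i, φ i (v i) = π v := by
    intro v
    simp only [φ, LinearMap.comp_apply, LinearMap.coe_single]
    rw [← map_sum, Finset.univ_sum_single]
  let T : Tens act (Fin k → Module.End R M) := ofPi act k φ
  have hT : tmap act ρ T = 0 := by
    rw [← ofPi_toPi act hmul l (tmap act ρ T)]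
    have : toPi act hmul l (tmap act ρ T) = 0 := by
      simp only [T, ofPi_apply, map_sum, tmap_pure, toPi_pure]
      funext j
      ext m
      simp only [Finset.sum_apply, LinearMap.sum_apply]
      have h1 : ∀ i, act (φ i) (ρ (Pi.single i 1) j) m = φ i (g (Pi.single j m) i) := by
        intro i
        change φ i (ρ (Pi.single i 1) j m) = _
        rw [hρ, Finset.sum_eq_single i]
        · simp
        · intro b _ hb
          simp [Pi.single_eq_of_ne hb]
        · simp
      simp only [h1]
      rw [hsum]
      have : g (Pi.single j m) ∈ LinearMap.ker π := hg ▸ ⟨_, rfl⟩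
      exact this
    rw [this, map_zero]
  have hT' : tmap act ρ.rangeRestrict T = 0 := by
    apply flat act hmul hd hX hgl (Fin l → Module.End R M) (LinearMap.range ρ)
    rw [map_zero, tmap_comp]
    exact hT
  have hex : Function.Exact (LinearMap.ker ρ).subtype ρ.rangeRestrict := by
    intro y
    rw [← LinearMap.mem_ker, LinearMap.ker_rangeRestrict]
    simp
  obtain ⟨s, hs⟩ := (tmap_exact act _ _ hex ρ.surjective_rangeRestrict T).1 hT'
  have key : ∀ s : Tens act (LinearMap.ker ρ), ∃ (r : ℕ) (ψ : Fin r → (M →ₗ[R] ω))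
      (κ : Fin r → (ω →ₗ[R] M)), ∀ v : Fin k → M,
        ∑ i, toPi act hmul k (tmap act (LinearMap.ker ρ).subtype s) i (v i)
          = ∑ a, ψ a (κ a (π v)) := by
    intro s
    induction s using tens_induction with
    | h0 => exact ⟨0, Fin.elim0, Fin.elim0, by simp⟩
    | hp x n =>
      let f : (Fin k → M) →ₗ[R] M := ∑ i, (n : Fin k → Module.End R M) i ∘ₗ LinearMap.proj i
      have hfv : ∀ v, f v = ∑ i, (n : Fin k → Module.End R M) i (v i) := by
        intro v; simp [f, LinearMap.sum_apply]
      have hfg : f ∘ₗ g = 0 := by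
        ext j m
        have h1 : ρ n j m = 0 := by
          have : ρ n = 0 := n.2
          rw [this]; rfl
        rw [hρ] at h1
        simpa [hfv] using h1
      have hker : LinearMap.ker π ≤ LinearMap.ker f := by
        rw [← hg]
        rintro _ ⟨w, rfl⟩
        exact LinearMap.congr_fun hfg w
      let κ : ω →ₗ[R] M := (LinearMap.ker π).liftQ f hker ∘ₗ
        (π.quotKerEquivOfSurjective hπ).symm.toLinearMap
      have hκ : ∀ v, κ (π v) = f v := by
        intro v
        have : (π.quotKerEquivOfSurjective hπ).symm (π v) = (LinearMap.ker π).mkQ v := by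
          rw [LinearEquiv.symm_apply_eq]; rfl
        change (LinearMap.ker π).liftQ f hker ((π.quotKerEquivOfSurjective hπ).symm (π v)) = f v
        rw [this]; rfl
      refine ⟨1, fun _ => x, fun _ => κ, fun v => ?_⟩
      have h2 : κ (π v) = f v := hκ v
      simp only [tmap_pure, toPi_pure, Finset.univ_unique, Finset.sum_singleton, h2, hfv, map_sum]
      rfl
    | hadd s t hs ht =>
      obtain ⟨r, ψ, κ, h⟩ := hs
      obtain ⟨r', ψ', κ', h'⟩ := ht
      refine ⟨r + r', Fin.append ψ ψ', Fin.append κ κ', fun v => ?_⟩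
      simp only [map_add, Pi.add_apply, LinearMap.add_apply, Finset.sum_add_distrib, h, h',
        Fin.sum_univ_add, Fin.append_left, Fin.append_right]
  obtain ⟨r, ψ, κ, h⟩ := key s
  have hTP : toPi act hmul k T = φ := by
    simp only [T, ofPi_apply, map_sum, toPi_pure]
    funext j
    ext m
    simp only [Finset.sum_apply, LinearMap.sum_apply]
    rw [Finset.sum_eq_single j]
    · change φ j ((Pi.single j (1 : Module.End R M) : Fin k → Module.End R M) j m) = _
      simp
    · intro b _ hb
      change φ b ((Pi.single b (1 : Module.End R M) : Fin k → Module.End R M) j m) = _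
      simp [Pi.single_eq_of_ne hb.symm]
    · simp
  refine ⟨r, LinearMap.pi κ, ∑ a, ψ a ∘ₗ LinearMap.proj a, ?_⟩
  ext y
  obtain ⟨v, rfl⟩ := hπ y
  have := h v
  rw [hs, hTP, hsum] at this
  simp [LinearMap.sum_apply, ← this]

theorem exists_cover {R M : Type} [CommRing R] [AddCommGroup M] [Module R M]
    (e : M →ₗ[R] R) (he : Function.Surjective e) (N : Type) [AddCommGroup N] [Module R N]
    [Module.Finite R N] : ∃ (k : ℕ) (π : (Fin k → M) →ₗ[R] N), Function.Surjective π := by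
  obtain ⟨k, p, hp⟩ := Module.Finite.exists_fin' R N
  refine ⟨k, p ∘ₗ e.compLeft (Fin k), hp.comp ?_⟩
  intro v
  choose f hf using he
  exact ⟨fun i => f (v i), by funext i; simp [hf]⟩

end CanAdd

/-- Let `R` be a Cohen-Macaulay local ring of dimension `d ≥ 3` with isolated singularity
and canonical module `ω`, and `M` a maximal Cohen-Macaulay module with a free summand such
that `A = Hom_R(M,M)` is maximal Cohen-Macaulay.  If `gl.dim A ≤ d`, then `ω ∈ add M`. -/
theorem canonical_module_mem_add_of_globalDimension_le
    (R : Type) [CommRing R] [IsLocalRing R] (hCM : IsCohenMacaulayLocalRing R)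
    (d : ℕ) (hd : 3 ≤ d) (hdim : ringKrullDim R = d)
    (hisol : ∀ (q : Ideal R) [q.IsPrime], q ≠ IsLocalRing.maximalIdeal R →
      IsRegularLocal (Localization.AtPrime q))
    (ω : Type) [AddCommGroup ω] [Module R ω] (hω : IsCanonicalModule R ω)
    (M : Type) [AddCommGroup M] [Module R M] (hM : IsMCM R M)
    (hfree : ∃ N : Submodule R M, Nonempty (M ≃ₗ[R] R × N))
    (hA : IsMCM R (M →ₗ[R] M))
    (hgl : globalDimension (Module.End R M) ≤ (d : ℕ∞)) :
    InAdd R M ω := by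
  classical
  have hN : IsNoetherianRing R := hCM.1
  have hfM : Module.Finite R M := hM.1
  have hfω : Module.Finite R ω := hω.1
  have hMd : ∀ j, j < d → CanAdd.EZ R (ResidueField R) M j := by
    intro j hj
    apply CanAdd.EZ.of_old
    by_contra hns
    rw [not_subsingleton_iff_nontrivial] at hns
    have h1 : moduleDepth R M ≤ (j : ℕ∞) := sInf_le ⟨j, rfl, hns⟩
    have h2 := hM.2
    rw [hdim] at h2
    have h3 : moduleDepth R M = (d : ℕ∞) := by exact_mod_cast h2
    rw [h3] at h1
    have h4 : d ≤ j := by exact_mod_cast h1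
    omega
  have hωd : ∀ i, i ≠ d → CanAdd.EZ R (ResidueField R) ω i := by
    intro i hi
    apply CanAdd.EZ.of_old
    apply hω.2.1
    rw [hdim]
    intro h
    apply hi
    exact_mod_cast h
  have hext : ∀ i, 0 < i → CanAdd.EZ R M ω i := fun i hi =>
    CanAdd.EZ.depth_vanish (d := d) (fun i hi => hωd i (by omega)) d M hMd i (by omega)
  have hX : ∀ j, j < d → CanAdd.EZ R (ResidueField R) (M →ₗ[R] ω) j := fun j hj =>
    CanAdd.EZ.dual_depth (d := d) (fun i hi => hωd i (by omega)) j M hext hj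
  obtain ⟨N, ⟨E⟩⟩ := hfree
  let e : M →ₗ[R] R := LinearMap.fst R R N ∘ₗ E.toLinearMap
  have he : Function.Surjective e := fun y => ⟨E.symm (y, 0), by simp [e]⟩
  obtain ⟨k, π, hπ⟩ := CanAdd.exists_cover e he ω
  obtain ⟨l, g, hg⟩ := CanAdd.exists_cover e he (LinearMap.ker π)
  refine CanAdd.inAdd_of_surj (d := d) (by omega) hX (CanAdd.pd_of_gl _ d hgl) π hπ
    ((LinearMap.ker π).subtype ∘ₗ g) ?_
  rw [LinearMap.range_comp, LinearMap.range_eq_top.2 hg, Submodule.map_subtype_top]
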